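/- With δ_λ = Me_{Z_λ} − λ − 1/3, one has liminf_{λ→∞} λ·δ_λ = −8/405. -/

import Mathlib

open MeasureTheory ProbabilityTheory Filter Real Set
open scoped ENNReal NNReal

/-- Distribution of `Z_λ = N_λ + U`, `N_λ` Poisson(λ), `U` uniform on `(0,1)`, independent. -/
noncomputable def zMeasure (l : ℝ) : Measure ℝ :=
  Measure.map (fun p : ℝ × ℝ => p.1 + p.2)
    ((Measure.map (Nat.cast : ℕ → ℝ) (poissonMeasure l.toNNReal)).prod
      (volume.restrict (Set.Ioo (0 : ℝ) 1)))

/-- The median of `Z_λ`: `inf {t : P(Z_λ ≤ t) ≥ 1/2}`. -/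
noncomputable def medianZ (l : ℝ) : ℝ :=
  sInf {t : ℝ | (1 : ℝ≥0∞) / 2 ≤ zMeasure l (Set.Iic t)}

/-- The function `H` of the main theorem. -/
noncomputable def Hfun (x : ℝ) : ℝ :=
  if x ≤ 2 / 3 then x ^ 2 * (x - 1) / 3 + 4 / 135
  else x / 3 * (x ^ 2 - 4 * x + 5) - 86 / 135

/-- `w_n(x,k) = P(Z_{n+x} ≤ n + x + 1/3 + k/(n+x))`. -/
noncomputable def w (n : ℕ) (x k : ℝ) : ℝ :=
  (zMeasure (n + x) (Set.Iic ((n : ℝ) + x + 1 / 3 + k / (n + x)))).toReal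

/-- `r_n(x,k) = k/(n+x)`. -/
noncomputable def r (n : ℕ) (x k : ℝ) : ℝ := k / (n + x)

/-- `g_n(u) = e^{-u} u^n`. -/
noncomputable def g (n : ℕ) (u : ℝ) : ℝ := Real.exp (-u) * u ^ n

/-- `c_n(v,x) = ((n+v+x)/(n+1+x))^{n+1} e^{1-v}`. -/
noncomputable def c (n : ℕ) (v x : ℝ) : ℝ :=
  (((n : ℝ) + v + x) / ((n : ℝ) + 1 + x)) ^ (n + 1) * Real.exp (1 - v)

/-- `Δ_n(x,k) = ((n+1)!/g_{n+1}(n+1+x)) (w_{n+1}(x,k) - w_n(x,k))`. -/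
noncomputable def Δfun (n : ℕ) (x k : ℝ) : ℝ :=
  ((n + 1).factorial : ℝ) / g (n + 1) ((n : ℝ) + 1 + x) * (w (n + 1) x k - w n x k)

open scoped Topology

/-- The mass `e^{-l} l^j / j!` of the Poisson distribution with parameter `l` at `j`. -/
noncomputable def poissonMass (j : ℕ) (l : ℝ) : ℝ := Real.exp (-l) * l ^ j / j.factorial

/-- The probability that a Poisson variable with parameter `l` is less than `n`. -/
noncomputable def poissonSum (n : ℕ) (l : ℝ) : ℝ := ∑ j ∈ Finset.range n, poissonMass j l

lemma poissonMass_nonneg (j : ℕ) {l : ℝ} (hl : 0 ≤ l) : 0 ≤ poissonMass j l := by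
  unfold poissonMass; positivity

lemma poissonMass_pos (j : ℕ) {l : ℝ} (hl : 0 < l) : 0 < poissonMass j l := by
  unfold poissonMass; positivity

lemma poissonMass_succ (j : ℕ) (l : ℝ) :
    poissonMass (j + 1) l = poissonMass j l * (l / (j + 1)) := by
  unfold poissonMass
  rw [Nat.factorial_succ]
  push_cast
  have : (j.factorial : ℝ) ≠ 0 := by positivity
  field_simp
  ring

lemma poissonSum_succ (n : ℕ) (l : ℝ) :
    poissonSum (n + 1) l = poissonSum n l + poissonMass n l :=
  Finset.sum_range_succ _ _

lemma poissonSum_nonneg (n : ℕ) {l : ℝ} (hl : 0 ≤ l) : 0 ≤ poissonSum n l :=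
  Finset.sum_nonneg fun j _ => poissonMass_nonneg j hl

lemma poissonSum_le_one (n : ℕ) {l : ℝ} (hl : 0 ≤ l) : poissonSum n l ≤ 1 := by
  have h := Real.sum_le_exp_of_nonneg hl n
  calc poissonSum n l = Real.exp (-l) * ∑ j ∈ Finset.range n, l ^ j / j.factorial := by
        simp only [poissonSum, poissonMass, Finset.mul_sum, mul_div_assoc]
    _ ≤ Real.exp (-l) * Real.exp l := by gcongr
    _ = 1 := by rw [← Real.exp_add]; simp

lemma poissonSum_succ_zero (n : ℕ) : poissonSum (n + 1) 0 = 1 := by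
  simp [poissonSum, poissonMass, Finset.sum_range_succ']

lemma hasDerivAt_poissonMass_zero (l : ℝ) :
    HasDerivAt (poissonMass 0) (-poissonMass 0 l) l := by
  have : poissonMass 0 = fun l => Real.exp (-l) := by funext l; simp [poissonMass]
  rw [this]
  simpa using (hasDerivAt_neg l).exp

lemma hasDerivAt_poissonMass_succ (j : ℕ) (l : ℝ) :
    HasDerivAt (poissonMass (j + 1)) (poissonMass j l - poissonMass (j + 1) l) l := by
  have h := (((hasDerivAt_neg l).exp).mul (hasDerivAt_pow (j + 1) l)).div_const
    ((j + 1).factorial : ℝ)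
  refine h.congr_deriv ?_
  unfold poissonMass
  rw [Nat.factorial_succ, Nat.add_sub_cancel]
  push_cast
  have : (j.factorial : ℝ) ≠ 0 := by positivity
  field_simp
  ring

lemma hasDerivAt_poissonSum_succ (n : ℕ) (l : ℝ) :
    HasDerivAt (poissonSum (n + 1)) (-poissonMass n l) l := by
  induction n with
  | zero =>
    have : poissonSum (0 + 1) = poissonMass 0 := by funext l; simp [poissonSum]
    rw [this]
    exact hasDerivAt_poissonMass_zero l
  | succ n ih =>
    have : poissonSum (n + 1 + 1) = poissonSum (n + 1) + poissonMass (n + 1) := by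
      funext l; exact poissonSum_succ _ _
    rw [this]
    exact (ih.add (hasDerivAt_poissonMass_succ n l)).congr_deriv (by ring)

lemma tendsto_poissonSum_atTop (n : ℕ) : Tendsto (poissonSum n) atTop (𝓝 0) := by
  have h : Tendsto (fun l => ∑ j ∈ Finset.range n, poissonMass j l) atTop
      (𝓝 (∑ j ∈ Finset.range n, 0)) := by
    refine tendsto_finsetSum _ fun j _ => ?_
    have := (Real.tendsto_pow_mul_exp_neg_atTop_nhds_zero j).div_const (j.factorial : ℝ)
    rw [zero_div] at this
    exact this.congr fun l => by rw [poissonMass, mul_comm]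
  rwa [Finset.sum_const_zero] at h

lemma poissonSum_succ_self_le_half (n : ℕ) : poissonSum (n + 1) ((n : ℝ) + 1) ≤ 1 / 2 := by
  set m : ℝ := (n : ℝ) + 1 with hm
  have hm0 : 0 < m := by positivity
  let φ : ℝ → ℝ := fun s => poissonSum (n + 1) (m * Real.exp s) +
    poissonSum (n + 1) (m * Real.exp (-s))
  have hd : ∀ s, HasDerivAt φ (-poissonMass n (m * Real.exp s) * (m * Real.exp s) +
      -poissonMass n (m * Real.exp (-s)) * (m * (Real.exp (-s) * -1))) s := fun s =>
    ((hasDerivAt_poissonSum_succ n _).comp s ((Real.hasDerivAt_exp s).const_mul m)).add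
      ((hasDerivAt_poissonSum_succ n _).comp s (((hasDerivAt_neg s).exp).const_mul m))
  have hmono : MonotoneOn φ (Ici 0) := by
    refine monotoneOn_of_hasDerivWithinAt_nonneg (convex_Ici 0)
      (fun s _ => (hd s).continuousAt.continuousWithinAt)
      (fun s _ => (hd s).hasDerivWithinAt) fun s hs => ?_
    rw [interior_Ici, mem_Ioi] at hs
    have key : ∀ u, poissonMass n (m * Real.exp u) * (m * Real.exp u) =
        m ^ (n + 1) / n.factorial * Real.exp (m * (u - Real.exp u)) := by
      intro u
      have : Real.exp (m * (u - Real.exp u)) =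
          Real.exp (-(m * Real.exp u)) * Real.exp u ^ (n + 1) := by
        rw [← Real.exp_nat_mul, ← Real.exp_add]
        congr 1
        push_cast
        rw [← hm]
        ring
      rw [this, poissonMass, mul_pow, pow_succ, pow_succ]
      ring
    have h1 : Real.exp (m * (s - Real.exp s)) ≤ Real.exp (m * (-s - Real.exp (-s))) := by
      have := Real.self_le_sinh_iff.2 hs.le
      rw [Real.sinh_eq] at this
      refine Real.exp_le_exp.2 (mul_le_mul_of_nonneg_left ?_ hm0.le)
      linarith
    have h2 := mul_le_mul_of_nonneg_left h1
      (show 0 ≤ m ^ (n + 1) / (n.factorial : ℝ) by positivity)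
    rw [← key, ← key] at h2
    linarith
  have hle : ∀ s, 0 ≤ s → φ 0 ≤ poissonSum (n + 1) (m * Real.exp s) + 1 := fun s hs =>
    (hmono (mem_Ici.2 le_rfl) hs hs).trans
      (add_le_add_right (poissonSum_le_one _ (by positivity)) _)
  have hlim : Tendsto (fun s => poissonSum (n + 1) (m * Real.exp s) + 1) atTop (𝓝 (0 + 1)) :=
    ((tendsto_poissonSum_atTop _).comp
      (Real.tendsto_exp_atTop.const_mul_atTop hm0)).add_const 1
  have := ge_of_tendsto hlim ((eventually_ge_atTop 0).mono hle)
  simp only [φ, neg_zero, Real.exp_zero, mul_one] at this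
  linarith

lemma one_sub_mul_exp_le {y : ℝ} (h0 : 0 ≤ y) (h1 : y < 1) :
    (1 - y) * Real.exp y ≤ (1 + y) * Real.exp (-y) := by
  have hs := Real.hasSum_log_sub_log_of_abs_lt_one (x := y) (by rwa [abs_of_nonneg h0])
  have hl : 2 * y ≤ Real.log (1 + y) - Real.log (1 - y) := by
    have := le_hasSum hs 0 fun j _ => by positivity
    simpa using this
  rw [← Real.exp_log (show 0 < 1 - y by linarith), ← Real.exp_log (show 0 < 1 + y by linarith),
    ← Real.exp_add, ← Real.exp_add, Real.exp_le_exp]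
  linarith

lemma half_le_poissonSum_succ (m : ℕ) : 1 / 2 ≤ poissonSum (m + 1) m := by
  rcases Nat.eq_zero_or_pos m with rfl | hm
  · rw [Nat.cast_zero, poissonSum_succ_zero]; norm_num
  have hm0 : (0 : ℝ) < m := by exact_mod_cast hm
  let φ : ℝ → ℝ := fun t => poissonSum (m + 1) (m + t) + poissonSum (m + 1) (m - t)
  have hd : ∀ t, HasDerivAt φ (-poissonMass m (m + t) * 1 + -poissonMass m (m - t) * (-1)) t :=
    fun t => ((hasDerivAt_poissonSum_succ m _).comp t ((hasDerivAt_id t).const_add _)).add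
      ((hasDerivAt_poissonSum_succ m _).comp t ((hasDerivAt_id t).const_sub _))
  have hanti : AntitoneOn φ (Icc 0 m) := by
    refine antitoneOn_of_hasDerivWithinAt_nonpos (convex_Icc 0 _)
      (fun t _ => (hd t).continuousAt.continuousWithinAt)
      (fun t _ => (hd t).hasDerivWithinAt) fun t ht => ?_
    rw [interior_Icc, mem_Ioo] at ht
    have key : ∀ u, poissonMass m (m + u) = Real.exp (-m) * m ^ m / m.factorial *
        ((1 + u / m) * Real.exp (-(u / m))) ^ m := by
      intro u
      rw [mul_pow, ← Real.exp_nat_mul, poissonMass,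
        show -((m : ℝ) + u) = -m + m * -(u / m) by field_simp; ring, Real.exp_add,
        show (m : ℝ) + u = m * (1 + u / m) by field_simp, mul_pow]
      ring
    have hy : t / m < 1 := (div_lt_one hm0).2 ht.2
    have h1 := one_sub_mul_exp_le (div_nonneg ht.1.le hm0.le) hy
    have h2 : poissonMass m (m - t) ≤ poissonMass m (m + t) := by
      rw [sub_eq_add_neg, key, key]
      have : 0 ≤ 1 - t / m := by linarith
      rw [neg_div, neg_neg, ← sub_eq_add_neg]
      gcongr
    linarith
  have h := hanti ⟨le_rfl, hm0.le⟩ ⟨hm0.le, le_rfl⟩ hm0.le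
  simp only [φ, add_zero, sub_zero, sub_self, poissonSum_succ_zero] at h
  have := poissonSum_nonneg (m + 1) (show (0 : ℝ) ≤ m + m by positivity)
  linarith

lemma tendsto_poissonMass_self : Tendsto (fun n : ℕ => poissonMass n n) atTop (𝓝 0) := by
  have hlim : Tendsto (fun n : ℕ => (√(2 * π * n))⁻¹) atTop (𝓝 0) :=
    (Real.tendsto_sqrt_atTop.comp
      (tendsto_natCast_atTop_atTop.const_mul_atTop (by positivity))).inv_tendsto_atTop
  refine squeeze_zero' (.of_forall fun n => poissonMass_nonneg n n.cast_nonneg) ?_ hlim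
  filter_upwards [eventually_gt_atTop 0] with n hn
  have hn0 : (0 : ℝ) < n := by exact_mod_cast hn
  have hs : 0 < √(2 * π * n) := by positivity
  rw [poissonMass, div_le_iff₀ (by positivity), ← div_eq_inv_mul, le_div_iff₀ hs]
  have h := Stirling.le_factorial_stirling n
  rw [div_pow, ← Real.exp_nat_mul, mul_one] at h
  rw [Real.exp_neg, mul_comm]
  simpa [div_eq_inv_mul] using h

lemma tendsto_poissonSum_self : Tendsto (fun n : ℕ => poissonSum n n) atTop (𝓝 (1 / 2)) := by
  have hlim : Tendsto (fun n : ℕ => 1 / 2 - poissonMass n n) atTop (𝓝 (1 / 2)) := by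
    simpa only [sub_zero] using tendsto_poissonMass_self.const_sub (1 / 2)
  refine tendsto_of_tendsto_of_tendsto_of_le_of_le' hlim tendsto_const_nhds
    (.of_forall fun n => ?_) ?_
  · have := half_le_poissonSum_succ n
    rw [poissonSum_succ] at this
    linarith
  · filter_upwards [eventually_gt_atTop 0] with n hn
    obtain ⟨k, rfl⟩ := Nat.exists_eq_succ_of_ne_zero hn.ne'
    simpa using poissonSum_succ_self_le_half k

lemma exp_neg_mul_one_add_div_pow {n : ℕ} (hn : 2 ≤ n) {v : ℝ} (h0 : 0 ≤ v) (h1 : v ≤ 1) :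
    |Real.exp (-v) * (1 + v / (n : ℝ)) ^ n -
      (1 - v ^ 2 / (2 * n) + (v ^ 3 / 3 + v ^ 4 / 8) / n ^ 2)| ≤ 7 / (n : ℝ) ^ 3 := by
  have hn2 : (2 : ℝ) ≤ n := by exact_mod_cast hn
  have hn0 : (0 : ℝ) < n := by linarith
  obtain ⟨h, hh⟩ : ∃ h : ℝ, h = 1 / n := ⟨_, rfl⟩
  have hpos : 0 < h := hh ▸ by positivity
  have hhalf : h ≤ 1 / 2 := by rw [hh]; gcongr
  have hnh : n * h = 1 := by rw [hh]; field_simp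
  have hy0 : 0 ≤ v * h := by positivity
  have hyh : v * h ≤ h := mul_le_of_le_one_left hpos.le h1
  set L : ℝ := n * Real.log (1 + v * h) - v with hL
  have hE : Real.exp (-v) * (1 + v / n) ^ n = Real.exp L := by
    rw [show v / n = v * h by rw [hh]; ring, hL, sub_eq_neg_add, Real.exp_add, Real.exp_nat_mul,
      Real.exp_log (by linarith)]
  have hgoal : (1 - v ^ 2 / (2 * n) + (v ^ 3 / 3 + v ^ 4 / 8) / n ^ 2) =
      1 - v ^ 2 * h / 2 + (v ^ 3 / 3 + v ^ 4 / 8) * h ^ 2 := by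
    rw [hh]; field_simp
  rw [hE, hgoal, show 7 / (n : ℝ) ^ 3 = 7 * h ^ 3 by rw [hh]; field_simp]
  have hv2 : v ^ 2 ≤ 1 := pow_le_one₀ h0 h1
  have hv3 : v ^ 3 ≤ 1 := pow_le_one₀ h0 h1
  have hv4 : v ^ 4 ≤ 1 := pow_le_one₀ h0 h1
  obtain ⟨e, he⟩ : ∃ e : ℝ, e = L + v ^ 2 * h / 2 - v ^ 3 * h ^ 2 / 3 := ⟨_, rfl⟩
  have heb : |e| ≤ 2 * h ^ 3 := by
    have hlog := Real.abs_log_sub_add_sum_range_le (x := -(v * h))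
      (by rw [abs_neg, abs_of_nonneg hy0]; linarith) 3
    rw [abs_neg, abs_of_nonneg hy0, sub_neg_eq_add] at hlog
    have h4 : (v * h) ^ (3 + 1) / (1 - v * h) ≤ 2 * h ^ 4 := by
      rw [div_le_iff₀ (by linarith), mul_pow, show 3 + 1 = 4 from rfl]
      have : v ^ 4 * h ^ 4 ≤ 1 * h ^ 4 := by gcongr
      nlinarith [mul_nonneg (pow_pos hpos 4).le (show 0 ≤ 1 / 2 - v * h by linarith)]
    have heq : e = n * ((∑ i ∈ Finset.range 3, (-(v * h)) ^ (i + 1) / ((i : ℝ) + 1)) +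
        Real.log (1 + v * h)) := by
      rw [he, hL]
      simp only [Finset.sum_range_succ, Finset.sum_range_zero]
      push_cast
      linear_combination (v - v ^ 2 * h / 2 + v ^ 3 * h ^ 2 / 3) * hnh
    rw [heq, abs_mul, abs_of_pos hn0]
    calc n * _ ≤ n * (2 * h ^ 4) := by gcongr; exact hlog.trans h4
      _ = 2 * h ^ 3 := by linear_combination (2 * h ^ 3) * hnh
  have hh2 : h ^ 2 ≤ h / 2 := by nlinarith
  have hh3 : h ^ 3 ≤ h ^ 2 / 2 := by nlinarith [pow_pos hpos 2]
  have hb0 : 0 ≤ v ^ 3 * h ^ 2 := by positivity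
  have hb1 : v ^ 3 * h ^ 2 ≤ h ^ 2 := mul_le_of_le_one_left (by positivity) hv3
  have ha0 : 0 ≤ v ^ 2 * h := by positivity
  have ha1 : v ^ 2 * h ≤ h := mul_le_of_le_one_left hpos.le hv2
  obtain ⟨he1, he2⟩ := abs_le.1 heb
  have hLb : |L| ≤ 2 * h := abs_le.2 ⟨by linarith, by linarith⟩
  have hsum : |L + v ^ 2 * h / 2| ≤ 2 * h ^ 2 := abs_le.2 ⟨by linarith, by linarith⟩
  have hdiff : |L - v ^ 2 * h / 2| ≤ 3 * h := by
    obtain ⟨_, _⟩ := abs_le.1 hLb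
    exact abs_le.2 ⟨by linarith, by linarith⟩
  have hsq : |L ^ 2 / 2 - (v ^ 2 * h / 2) ^ 2 / 2| ≤ 3 * h ^ 3 := by
    rw [show L ^ 2 / 2 - (v ^ 2 * h / 2) ^ 2 / 2 =
      (L + v ^ 2 * h / 2) * (L - v ^ 2 * h / 2) / 2 by ring, abs_div, abs_mul, abs_two]
    calc _ ≤ (2 * h ^ 2) * (3 * h) / 2 := by gcongr
      _ = 3 * h ^ 3 := by ring
  have hexp : |Real.exp L - (1 + L + L ^ 2 / 2)| ≤ 2 * h ^ 3 := by
    have h3 := Real.exp_bound (x := L) (by linarith) (n := 3) (by norm_num)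
    norm_num [Finset.sum_range_succ, Nat.factorial] at h3
    have : |L| ^ 3 ≤ (2 * h) ^ 3 := by gcongr
    refine h3.trans ?_
    nlinarith [pow_pos hpos 3]
  rw [show Real.exp L - (1 - v ^ 2 * h / 2 + (v ^ 3 / 3 + v ^ 4 / 8) * h ^ 2) =
    (Real.exp L - (1 + L + L ^ 2 / 2)) + (L ^ 2 / 2 - (v ^ 2 * h / 2) ^ 2 / 2) + e by
      rw [he]; ring]
  exact (abs_add_three _ _ _).trans (by linarith)

lemma exists_remainder_of_abs_sub_le {a b C d : ℝ} (hd : 0 < d) (h : |a - b| ≤ C / d) :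
    ∃ f, |f| ≤ C ∧ a = b + f / d := by
  refine ⟨(a - b) * d, ?_, by field_simp; ring⟩
  rw [abs_mul, abs_of_pos hd]
  exact (le_div_iff₀ hd).1 h

lemma poissonMass_add {n : ℕ} (hn : 0 < n) (v : ℝ) :
    poissonMass n (n + v) = poissonMass n n * (Real.exp (-v) * (1 + v / n) ^ n) := by
  have hn0 : (0 : ℝ) < n := by exact_mod_cast hn
  rw [poissonMass, poissonMass, neg_add, Real.exp_add,
    show (n : ℝ) + v = n * (1 + v / n) by field_simp, mul_pow]
  ring

/-- Second-order expansion of the Poisson mass at its mode under a shift of the parameter. -/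
lemma exists_poissonMass_add_expansion {n : ℕ} (hn : 2 ≤ n) {v : ℝ} (h0 : 0 ≤ v) (h1 : v ≤ 1) :
    ∃ f, |f| ≤ 7 ∧ poissonMass n (n + v) = poissonMass n n *
      (1 - v ^ 2 / (2 * n) + (v ^ 3 / 3 + v ^ 4 / 8) / n ^ 2 + f / n ^ 3) := by
  have hn0 : (0 : ℝ) < n := by exact_mod_cast (by omega : 0 < n)
  obtain ⟨f, hf, he⟩ := exists_remainder_of_abs_sub_le (by positivity)
    (exp_neg_mul_one_add_div_pow hn h0 h1)
  exact ⟨f, hf, by rw [poissonMass_add (by omega), he]⟩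

/-- Second-order expansion of the Poisson distribution function at the integer part of its
parameter. -/
lemma exists_poissonSum_add_expansion {n : ℕ} (hn : 2 ≤ n) {x : ℝ} (h0 : 0 ≤ x) (h1 : x ≤ 1) :
    ∃ f, |f| ≤ 7 ∧ poissonSum (n + 1) (n + x) = poissonSum (n + 1) n - poissonMass n n *
      (x - x ^ 3 / (6 * n) + (x ^ 4 / 12 + x ^ 5 / 40) / n ^ 2 + f / n ^ 3) := by
  have hn0 : (0 : ℝ) < n := by exact_mod_cast (by omega : 0 < n)
  set E : ℝ → ℝ := fun v => Real.exp (-v) * (1 + v / n) ^ n with hE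
  set P : ℝ → ℝ := fun v => 1 - v ^ 2 / (2 * n) + (v ^ 3 / 3 + v ^ 4 / 8) / n ^ 2 with hP
  have hEc : Continuous E := by fun_prop
  have hPc : Continuous P := by fun_prop
  have hS : poissonSum (n + 1) (n + x) = poissonSum (n + 1) n -
      poissonMass n n * ∫ v in (0 : ℝ)..x, E v := by
    have hd : ∀ v ∈ uIcc 0 x, HasDerivAt (fun v => poissonSum (n + 1) (n + v))
        (-(poissonMass n n) * E v) v := fun v _ =>
      ((hasDerivAt_poissonSum_succ n _).comp v ((hasDerivAt_id v).const_add _)).congr_deriv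
        (by rw [id, poissonMass_add (by omega)]; ring)
    have := intervalIntegral.integral_eq_sub_of_hasDerivAt hd
      ((hEc.const_mul _).intervalIntegrable _ _)
    rw [intervalIntegral.integral_const_mul] at this
    simp only [add_zero] at this
    linarith
  have hPi : ∫ v in (0 : ℝ)..x, P v =
      x - x ^ 3 / (6 * n) + (x ^ 4 / 12 + x ^ 5 / 40) / n ^ 2 := by
    have hd : ∀ v ∈ uIcc 0 x, HasDerivAt
        (fun v : ℝ => v - v ^ 3 / (6 * n) + (v ^ 4 / 12 + v ^ 5 / 40) / n ^ 2) (P v) v := by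
      intro v _
      refine (((hasDerivAt_id v).sub ((hasDerivAt_pow 3 v).div_const _)).add
        ((((hasDerivAt_pow 4 v).div_const 12).add
          ((hasDerivAt_pow 5 v).div_const 40)).div_const _)).congr_deriv ?_
      simp only [hP]
      push_cast
      field_simp
      ring
    rw [intervalIntegral.integral_eq_sub_of_hasDerivAt hd (hPc.intervalIntegrable _ _)]
    ring
  have hb : |(∫ v in (0 : ℝ)..x, E v) - ∫ v in (0 : ℝ)..x, P v| ≤ 7 / (n : ℝ) ^ 3 := by
    rw [← intervalIntegral.integral_sub (hEc.intervalIntegrable _ _)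
      (hPc.intervalIntegrable _ _), ← Real.norm_eq_abs]
    refine (intervalIntegral.norm_integral_le_of_norm_le_const (C := 7 / (n : ℝ) ^ 3)
      fun v hv => ?_).trans ?_
    · rw [uIoc_of_le h0] at hv
      exact exp_neg_mul_one_add_div_pow hn hv.1.le (hv.2.trans h1)
    · rw [sub_zero, abs_of_nonneg h0]
      exact mul_le_of_le_one_right (by positivity) h1
  obtain ⟨f, hf, he⟩ := exists_remainder_of_abs_sub_le (by positivity) hb
  exact ⟨f, hf, by rw [hS, he, hPi]⟩

/-- The increment of `n ↦ P(Z_n ≤ n + 1/3 + k/n)` over the integers. -/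
lemma exists_increment_eq (k : ℝ) {n : ℕ} (hn : 2 ≤ n) :
    ∃ e, |e| ≤ 10 + 6 * |k| ∧
      poissonSum (n + 1) ((n + 1 : ℕ) : ℝ) +
          (1 / 3 + k / ((n + 1 : ℕ) : ℝ)) * poissonMass (n + 1) ((n + 1 : ℕ) : ℝ) =
        poissonSum n n + (1 / 3 + k / n) * poissonMass n n +
          poissonMass n n / n ^ 2 * (2 / 45 - 3 * k / 2 + e / n) := by
  have hn2 : (2 : ℝ) ≤ n := by exact_mod_cast hn
  have hn0 : (0 : ℝ) < n := by linarith
  obtain ⟨f, hf, hM⟩ := exists_poissonMass_add_expansion hn zero_le_one le_rfl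
  obtain ⟨g, hg, hS⟩ := exists_poissonSum_add_expansion hn zero_le_one le_rfl
  push_cast
  refine ⟨-g + f / 3 + k * ((47 / 24 * n + f) / (n + 1)), ?_, ?_⟩
  · have hq : |(47 / 24 * n + f) / ((n : ℝ) + 1)| ≤ 6 := by
      obtain ⟨_, _⟩ := abs_le.1 hf
      rw [abs_div, abs_of_pos (show (0 : ℝ) < n + 1 by linarith), div_le_iff₀ (by linarith)]
      exact abs_le.2 ⟨by linarith, by linarith⟩
    have hk : |k * ((47 / 24 * n + f) / ((n : ℝ) + 1))| ≤ 6 * |k| := by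
      rw [abs_mul, mul_comm]
      gcongr
    have h3 := abs_add_three (-g) (f / 3) (k * ((47 / 24 * n + f) / ((n : ℝ) + 1)))
    rw [abs_neg, abs_div, abs_of_pos (show (0 : ℝ) < 3 by norm_num)] at h3
    linarith
  · rw [poissonMass_succ, div_self (by positivity), mul_one, hM, hS, poissonSum_succ]
    field_simp
    ring

/-- The function `n ↦ P(Z_n ≤ n + 1/3 + k/n)`, corrected by the change of the parameter from `n`
to `n + x`. -/
lemma exists_shift_eq (k k' : ℝ) {n : ℕ} (hn : 2 ≤ n) {x : ℝ} (h0 : 0 ≤ x) (h1 : x ≤ 1) :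
    ∃ e, |e| ≤ 24 + 13 * |k| ∧
      poissonSum n (n + x) + (x + 1 / 3 + k / (n + x)) * poissonMass n (n + x) =
        poissonSum n n + (1 / 3 + k' / n) * poissonMass n n +
          poissonMass n n / n * (k - k' + (x ^ 2 - x ^ 3) / 3 + e / n) := by
  have hn2 : (2 : ℝ) ≤ n := by exact_mod_cast hn
  have hn0 : (0 : ℝ) < n := by linarith
  obtain ⟨f, hf, hM⟩ := exists_poissonMass_add_expansion hn h0 h1
  obtain ⟨g, hg, hS⟩ := exists_poissonSum_add_expansion hn h0 h1
  have hx3 : x ^ 3 ≤ 1 := pow_le_one₀ h0 h1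
  have hx4 : x ^ 4 ≤ 1 := pow_le_one₀ h0 h1
  have hx5 : x ^ 5 ≤ 1 := pow_le_one₀ h0 h1
  have hx2 : x ^ 2 ≤ 1 := pow_le_one₀ h0 h1
  have hx2' : 0 ≤ x ^ 2 := by positivity
  have hx3' : 0 ≤ x ^ 3 := by positivity
  have hx4' : 0 ≤ x ^ 4 := by positivity
  have hx5' : 0 ≤ x ^ 5 := by positivity
  have hdiv : ∀ {f : ℝ}, |f| ≤ 7 → |f / n| ≤ 7 := fun {f} hf => by
    rw [abs_div, abs_of_pos hn0]
    exact (div_le_self (abs_nonneg f) (by linarith)).trans hf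
  obtain ⟨F, hFe⟩ : ∃ F : ℝ, F = x ^ 3 / 3 + x ^ 4 / 8 + f / n := ⟨_, rfl⟩
  obtain ⟨G, hGe⟩ : ∃ G : ℝ, G = x ^ 4 / 12 + x ^ 5 / 40 + g / n := ⟨_, rfl⟩
  obtain ⟨_, _⟩ := abs_le.1 (hdiv hf)
  obtain ⟨_, _⟩ := abs_le.1 (hdiv hg)
  have hF : |F| ≤ 8 := abs_le.2 ⟨by linarith, by linarith⟩
  have hG : |G| ≤ 8 := abs_le.2 ⟨by linarith, by linarith⟩
  have hM' : poissonMass n (n + x) = poissonMass n n * (1 - x ^ 2 / (2 * n) + F / n ^ 2) := by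
    rw [hM, hFe]; field_simp; ring
  have hS' : poissonSum (n + 1) (n + x) = poissonSum (n + 1) n -
      poissonMass n n * (x - x ^ 3 / (6 * n) + G / n ^ 2) := by
    rw [hS, hGe]; field_simp; ring
  refine ⟨-G + (x - 2 / 3) * F + k * ((-x * n - x ^ 2 * n / 2 + F) / (n + x)), ?_, ?_⟩
  · have hq : |(-x * n - x ^ 2 * n / 2 + F) / (n + x)| ≤ 13 := by
      obtain ⟨_, _⟩ := abs_le.1 hF
      have hxn : x * n ≤ n := mul_le_of_le_one_left hn0.le h1
      have hxn2 : x ^ 2 * n ≤ n := mul_le_of_le_one_left hn0.le hx2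
      have hxn' : 0 ≤ x * n := by positivity
      have hxn2' : 0 ≤ x ^ 2 * n := by positivity
      rw [abs_div, abs_of_pos (show (0 : ℝ) < n + x by linarith), div_le_iff₀ (by linarith)]
      exact abs_le.2 ⟨by linarith, by linarith⟩
    have hk : |k * ((-x * n - x ^ 2 * n / 2 + F) / (n + x))| ≤ 13 * |k| := by
      rw [abs_mul, mul_comm]
      gcongr
    have hxF : |(x - 2 / 3) * F| ≤ 1 * 8 := by
      rw [abs_mul]
      gcongr
      exact abs_le.2 ⟨by linarith, by linarith⟩
    have h3 := abs_add_three (-G) ((x - 2 / 3) * F)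
      (k * ((-x * n - x ^ 2 * n / 2 + F) / (n + x)))
    rw [abs_neg] at h3
    linarith
  · have hnx : (n : ℝ) + x ≠ 0 := by positivity
    have hsum := poissonSum_succ n (n + x : ℝ)
    rw [hS', hM', poissonSum_succ] at hsum
    rw [hM', eq_sub_of_add_eq hsum.symm]
    field_simp
    ring

lemma eventually_abs_div_lt {C d : ℝ} (hd : 0 < d) :
    ∀ᶠ n : ℕ in atTop, ∀ e : ℝ, |e| ≤ C → |e / n| < d := by
  filter_upwards [(tendsto_const_div_atTop_nhds_zero_nat C).eventually_lt_const hd] with n hn e he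
  rw [abs_div, Nat.abs_cast]
  exact (div_le_div_of_nonneg_right he n.cast_nonneg).trans_lt hn

lemma tendsto_poissonSum_add_mass (k : ℝ) :
    Tendsto (fun n : ℕ => poissonSum n n + (1 / 3 + k / n) * poissonMass n n) atTop
      (𝓝 (1 / 2)) := by
  have := tendsto_poissonSum_self.add
    (((tendsto_const_div_atTop_nhds_zero_nat k).const_add (1 / 3)).mul tendsto_poissonMass_self)
  simpa only [mul_zero, add_zero] using this

lemma eventually_poissonSum_add_mass_le {k : ℝ} (hk : k < 4 / 135) :
    ∀ᶠ n : ℕ in atTop, poissonSum n n + (1 / 3 + k / n) * poissonMass n n ≤ 1 / 2 := by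
  obtain ⟨N, hN⟩ := eventually_atTop.1 ((eventually_abs_div_lt (C := 10 + 6 * |k|)
    (show 0 < 2 / 45 - 3 * k / 2 by linarith)).and (eventually_ge_atTop 2))
  filter_upwards [eventually_ge_atTop N] with n hn
  have hmono : Monotone fun i : ℕ => poissonSum (n + i) ((n + i : ℕ) : ℝ) +
      (1 / 3 + k / ((n + i : ℕ) : ℝ)) * poissonMass (n + i) ((n + i : ℕ) : ℝ) := by
    refine monotone_nat_of_le_succ fun i => ?_
    obtain ⟨hsmall, h2⟩ := hN (n + i) (by omega)
    obtain ⟨e, he, heq⟩ := exists_increment_eq k h2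
    rw [← add_assoc, heq]
    refine le_add_of_nonneg_right (mul_nonneg (div_nonneg
      (poissonMass_nonneg _ (Nat.cast_nonneg _)) (by positivity)) ?_)
    linarith [(abs_lt.1 (hsmall e he)).1]
  have := hmono.ge_of_tendsto ((tendsto_poissonSum_add_mass k).comp
    (tendsto_atTop_mono (fun i => Nat.le_add_left i n) tendsto_id)) 0
  simpa only [add_zero] using this

lemma eventually_le_poissonSum_add_mass {k : ℝ} (hk : 4 / 135 < k) :
    ∀ᶠ n : ℕ in atTop, 1 / 2 ≤ poissonSum n n + (1 / 3 + k / n) * poissonMass n n := by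
  obtain ⟨N, hN⟩ := eventually_atTop.1 ((eventually_abs_div_lt (C := 10 + 6 * |k|)
    (show 0 < 3 * k / 2 - 2 / 45 by linarith)).and (eventually_ge_atTop 2))
  filter_upwards [eventually_ge_atTop N] with n hn
  have hanti : Antitone fun i : ℕ => poissonSum (n + i) ((n + i : ℕ) : ℝ) +
      (1 / 3 + k / ((n + i : ℕ) : ℝ)) * poissonMass (n + i) ((n + i : ℕ) : ℝ) := by
    refine antitone_nat_of_succ_le fun i => ?_
    obtain ⟨hsmall, h2⟩ := hN (n + i) (by omega)
    obtain ⟨e, he, heq⟩ := exists_increment_eq k h2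
    rw [← add_assoc, heq]
    refine add_le_of_nonpos_right (mul_nonpos_of_nonneg_of_nonpos (div_nonneg
      (poissonMass_nonneg _ (Nat.cast_nonneg _)) (by positivity)) ?_)
    linarith [(abs_lt.1 (hsmall e he)).2]
  have := hanti.le_of_tendsto ((tendsto_poissonSum_add_mass k).comp
    (tendsto_atTop_mono (fun i => Nat.le_add_left i n) tendsto_id)) 0
  simpa only [add_zero] using this

lemma isProbabilityMeasure_zMeasure (l : ℝ) : IsProbabilityMeasure (zMeasure l) := by
  have : IsProbabilityMeasure (volume.restrict (Set.Ioo (0 : ℝ) 1)) := ⟨by simp⟩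
  exact Measure.isProbabilityMeasure_map (by fun_prop)

lemma volume_restrict_Ioo_preimage_Iic (a t : ℝ) :
    volume.restrict (Set.Ioo (0 : ℝ) 1)
        (Prod.mk a ⁻¹' ((fun p : ℝ × ℝ => p.1 + p.2) ⁻¹' Set.Iic t)) =
      ENNReal.ofReal (max 0 (min 1 (t - a))) := by
  have h1 : Prod.mk a ⁻¹' ((fun p : ℝ × ℝ => p.1 + p.2) ⁻¹' Set.Iic t) = Set.Iic (t - a) := by
    ext u
    simp only [mem_preimage, mem_Iic]
    exact (le_sub_iff_add_le').symm
  rw [h1, Measure.restrict_congr_set Ioo_ae_eq_Ioc, Measure.restrict_apply measurableSet_Iic,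
    Set.inter_comm, Set.Ioc_inter_Iic, Real.volume_Ioc, sub_zero]
  rcases le_total 0 (min 1 (t - a)) with h | h
  · rw [max_eq_right h]
  · rw [max_eq_left h, ENNReal.ofReal_of_nonpos h, ENNReal.ofReal_zero]

/-- The distribution function of `Z_l`. -/
lemma zMeasure_Iic {l t : ℝ} (hl : 0 ≤ l) {N : ℕ} (ht : t ≤ N) :
    zMeasure l (Set.Iic t) = ENNReal.ofReal
      (∑ j ∈ Finset.range N, poissonMass j l * max 0 (min 1 (t - j))) := by
  have hmeas : MeasurableSet ((fun p : ℝ × ℝ => p.1 + p.2) ⁻¹' Set.Iic t) :=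
    measurableSet_Iic.preimage (by fun_prop)
  rw [zMeasure, Measure.map_apply (by fun_prop) measurableSet_Iic, Measure.prod_apply hmeas,
    lintegral_map (measurable_measure_prodMk_left hmeas) measurable_from_nat]
  simp only [volume_restrict_Ioo_preimage_Iic]
  rw [poissonMeasure, lintegral_sum_measure]
  simp only [lintegral_smul_measure, lintegral_dirac, smul_eq_mul, Real.coe_toNNReal l hl]
  rw [tsum_eq_sum (s := Finset.range N), ENNReal.ofReal_sum_of_nonneg]
  · exact Finset.sum_congr rfl fun j _ => (ENNReal.ofReal_mul (poissonMass_nonneg j hl)).symm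
  · exact fun j _ => mul_nonneg (poissonMass_nonneg j hl) (le_max_left _ _)
  · intro j hj
    have : (N : ℝ) ≤ j := by exact_mod_cast not_lt.1 (mt Finset.mem_range.2 hj)
    rw [max_eq_left ((min_le_right _ _).trans (by linarith)), ENNReal.ofReal_zero, mul_zero]

lemma sum_poissonMass_mul_clamp {n : ℕ} (l : ℝ) {t : ℝ} (ht : n ≤ t) :
    ∑ j ∈ Finset.range n, poissonMass j l * max 0 (min 1 (t - j)) = poissonSum n l := by
  refine Finset.sum_congr rfl fun j hj => ?_
  have : (j : ℝ) + 1 ≤ n := by exact_mod_cast Finset.mem_range.1 hj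
  rw [min_eq_left (by linarith), max_eq_right zero_le_one, mul_one]

lemma zMeasure_Iic_eq {l t : ℝ} (hl : 0 ≤ l) {n : ℕ} (h1 : n ≤ t) (h2 : t ≤ n + 1) :
    zMeasure l (Set.Iic t) = ENNReal.ofReal (poissonSum n l + (t - n) * poissonMass n l) := by
  rw [zMeasure_Iic hl (N := n + 1) (by exact_mod_cast h2), Finset.sum_range_succ,
    sum_poissonMass_mul_clamp l h1, min_eq_right (by linarith), max_eq_right (by linarith),
    mul_comm]

lemma zMeasure_Iic_le {l t : ℝ} (hl : 0 ≤ l) {n : ℕ} (hn : l ≤ n + 1) (h1 : n ≤ t)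
    (h2 : t ≤ n + 2) :
    zMeasure l (Set.Iic t) ≤ ENNReal.ofReal (poissonSum n l + (t - n) * poissonMass n l) := by
  rcases le_total t (n + 1) with h | h
  · exact (zMeasure_Iic_eq hl h1 h).le
  · have h' : ((n + 1 : ℕ) : ℝ) ≤ t := by exact_mod_cast h
    rw [zMeasure_Iic_eq hl h' (by push_cast; linarith)]
    refine ENNReal.ofReal_le_ofReal ?_
    have hp : poissonMass (n + 1) l ≤ poissonMass n l := by
      rw [poissonMass_succ]
      exact mul_le_of_le_one_right (poissonMass_nonneg n hl)
        ((div_le_one (by positivity)).2 hn)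
    rw [poissonSum_succ]
    push_cast
    nlinarith [mul_le_mul_of_nonneg_left hp (show 0 ≤ t - (n + 1) by linarith)]

lemma medianZ_le {l t : ℝ} (hl : 0 ≤ l) (h : 1 / 2 ≤ zMeasure l (Set.Iic t)) :
    medianZ l ≤ t := by
  refine csInf_le ⟨0, fun s hs => ?_⟩ h
  by_contra! hs0
  have hs' : 1 / 2 ≤ zMeasure l (Set.Iic s) := hs
  rw [zMeasure_Iic hl (N := 0) (by simpa using hs0.le)] at hs'
  simp at hs'

lemma le_medianZ {l t : ℝ} (h : zMeasure l (Set.Iic t) < 1 / 2) : t ≤ medianZ l := by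
  have := isProbabilityMeasure_zMeasure l
  refine le_csInf ?_ fun s hs => ?_
  · have hlim := tendsto_measure_Iic_atTop (zMeasure l)
    rw [measure_univ] at hlim
    obtain ⟨s, hs⟩ := (hlim.eventually_const_le
      (show (1 : ℝ≥0∞) / 2 < 1 by simp)).exists
    exact ⟨s, hs⟩
  · by_contra! hst
    exact absurd (hs.trans (measure_mono (Set.Iic_subset_Iic.2 hst.le))) (not_le.2 h)

lemma eventually_zMeasure_Iic_lt_half {k : ℝ} (hk : k < -8 / 405) :
    ∀ᶠ l : ℝ in atTop, zMeasure l (Set.Iic (l + 1 / 3 + k / l)) < 1 / 2 := by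
  have hd : 0 < (-8 / 405 - k) / 2 := by linarith
  have hn := (eventually_poissonSum_add_mass_le (k := 4 / 135 - (-8 / 405 - k) / 2)
    (by linarith)).and ((eventually_abs_div_lt (C := 24 + 13 * |k|) hd).and
      (eventually_ge_atTop 2))
  filter_upwards [(tendsto_nat_floor_atTop (α := ℝ)).eventually hn,
    eventually_ge_atTop (max 1 (3 * -k))] with l ⟨hW, hsmall, h2⟩ hl
  obtain ⟨n, hnl⟩ : ∃ n : ℕ, n = ⌊l⌋₊ := ⟨_, rfl⟩
  rw [← hnl] at hW hsmall h2
  have hl1 : 1 ≤ l := (le_max_left _ _).trans hl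
  have hlk : 3 * -k ≤ l := (le_max_right _ _).trans hl
  have hl0 : 0 < l := by linarith
  obtain ⟨x, hx⟩ : ∃ x : ℝ, x = l - n := ⟨_, rfl⟩
  have hx0 : 0 ≤ x := by rw [hx, hnl]; linarith [Nat.floor_le hl0.le]
  have hx1 : x ≤ 1 := by rw [hx, hnl]; linarith [Nat.lt_floor_add_one l]
  obtain rfl : l = n + x := by rw [hx]; ring
  have hn0 : (0 : ℝ) < n := by exact_mod_cast (by omega : 0 < n)
  have hkl : -(1 / 3) ≤ k / (n + x) := by rw [le_div_iff₀ hl0]; linarith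
  have hkl' : k / (n + x) ≤ 0 := div_nonpos_of_nonpos_of_nonneg (by linarith) hl0.le
  refine (zMeasure_Iic_le hl0.le (n := n) (by linarith) (by linarith) (by linarith)).trans_lt ?_
  obtain ⟨e, he, heq⟩ := exists_shift_eq k (4 / 135 - (-8 / 405 - k) / 2) h2 hx0 hx1
  rw [show (n : ℝ) + x + 1 / 3 + k / (n + x) - n = x + 1 / 3 + k / (n + x) by ring, heq,
    show (1 : ℝ≥0∞) / 2 = ENNReal.ofReal (1 / 2) by
      rw [ENNReal.ofReal_div_of_pos two_pos]; simp,
    ENNReal.ofReal_lt_ofReal_iff (by norm_num)]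
  have hcubic : (x ^ 2 - x ^ 3) / 3 ≤ 4 / 81 := by
    nlinarith [mul_nonneg (sq_nonneg (x - 2 / 3)) (show 0 ≤ x + 1 / 3 by linarith)]
  have hneg := mul_neg_of_pos_of_neg (div_pos (poissonMass_pos n hn0) hn0)
    (show k - (4 / 135 - (-8 / 405 - k) / 2) + (x ^ 2 - x ^ 3) / 3 + e / n < 0 by
      linarith [(abs_lt.1 (hsmall e he)).2])
  linarith

lemma eventually_half_le_zMeasure_Iic {k : ℝ} (hk : -8 / 405 < k) (hk0 : k ≤ 0) :
    ∀ᶠ n : ℕ in atTop, 1 / 2 ≤ zMeasure (n + 2 / 3)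
      (Set.Iic ((n + 2 / 3 : ℝ) + 1 / 3 + k / (n + 2 / 3))) := by
  have hd : 0 < (k - -8 / 405) / 2 := by linarith
  filter_upwards [eventually_le_poissonSum_add_mass (k := 4 / 135 + (k - -8 / 405) / 2)
    (by linarith), eventually_abs_div_lt (C := 24 + 13 * |k|) hd,
    eventually_ge_atTop 2] with n hW hsmall h2
  have hn0 : (0 : ℝ) < n := by exact_mod_cast (by omega : 0 < n)
  have hkl : -1 ≤ k / (n + 2 / 3) := by rw [le_div_iff₀ (by linarith)]; linarith
  have hkl' : k / (n + 2 / 3) ≤ 0 := div_nonpos_of_nonpos_of_nonneg hk0 (by linarith)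
  rw [zMeasure_Iic_eq (by linarith) (n := n) (by linarith) (by linarith)]
  obtain ⟨e, he, heq⟩ := exists_shift_eq k (4 / 135 + (k - -8 / 405) / 2) h2
    (x := 2 / 3) (by norm_num) (by norm_num)
  rw [show (n : ℝ) + 2 / 3 + 1 / 3 + k / (n + 2 / 3) - n = 2 / 3 + 1 / 3 + k / (n + 2 / 3) by ring,
    heq, show (1 : ℝ≥0∞) / 2 = ENNReal.ofReal (1 / 2) by
      rw [ENNReal.ofReal_div_of_pos two_pos]; simp]
  refine ENNReal.ofReal_le_ofReal ?_
  have hpos := mul_pos (div_pos (poissonMass_pos n hn0) hn0)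
    (show 0 < k - (4 / 135 + (k - -8 / 405) / 2) + ((2 / 3) ^ 2 - (2 / 3) ^ 3) / 3 + e / n by
      linarith [(abs_lt.1 (hsmall e he)).1])
  linarith

theorem liminf_median_jittered_poisson :
    Filter.liminf (fun l : ℝ => l * (medianZ l - l - 1 / 3)) atTop = -8 / 405 := by
  have hlower : ∀ k < (-8 / 405 : ℝ), ∀ᶠ l : ℝ in atTop,
      k ≤ l * (medianZ l - l - 1 / 3) := fun k hk => by
    filter_upwards [eventually_zMeasure_Iic_lt_half hk, eventually_gt_atTop 0] with l hl hl0
    have h : k / l ≤ medianZ l - l - 1 / 3 := by linarith [le_medianZ hl]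
    rwa [div_le_iff₀ hl0, mul_comm] at h
  rw [Filter.liminf_eq]
  refine csSup_eq_of_forall_le_of_forall_lt_exists_gt ⟨-1, hlower _ (by norm_num)⟩ ?_ ?_
  · intro a ha
    refine le_of_forall_gt_imp_ge_of_dense fun k hk => le_trans ?_ (min_le_left k 0)
    have hlim : Tendsto (fun n : ℕ => (n : ℝ) + 2 / 3) atTop atTop :=
      tendsto_atTop_add_const_right _ _ tendsto_natCast_atTop_atTop
    obtain ⟨n, hn, hhalf⟩ :=
      ((hlim.eventually ha).and (eventually_half_le_zMeasure_Iic
        (lt_min hk (by norm_num)) (min_le_right k 0))).exists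
    have hn0 : (0 : ℝ) < n + 2 / 3 := by positivity
    have h : medianZ (n + 2 / 3) - (n + 2 / 3) - 1 / 3 ≤ min k 0 / (n + 2 / 3) := by
      linarith [medianZ_le hn0.le hhalf]
    rw [le_div_iff₀ hn0, mul_comm] at h
    exact hn.trans h
  · intro k hk
    obtain ⟨k', hkk', hk'⟩ := exists_between hk
    exact ⟨k', hlower k' hk', hkk'⟩
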